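/- For each triple (n,d,m) in the list (6,3,1), (8,3,2), (10,3,3), (12,3,4), (4,4,0), (6,4,1) — in each of which m = n/2 − 2 — one has the strict inequality rank([P_{i+j}] + [(P̌_m)_{i+j}]) < K^d_n(m) := 2·C_{1^{n/2+1},(d−1)^{n/2+1}} − C_{1^{n−m+1},(d−1)^{m+1}}; explicitly the two sides are (6,8), (16,19), (32,36), (55,60), (11,12), (36,37) respectively. -/

import Mathlib

open Finset Matrix

/-- `ζ_{2d} = exp(2πi/(2d))`. -/
noncomputable def zeta2d (d : ℕ) : ℂ :=
  Complex.exp (2 * Real.pi * Complex.I / (2 * (d : ℂ)))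

/-- The even-position index `2e` in `{0,…,n+1}` (with `n = 2h`). -/
def evIdx (h : ℕ) (e : Fin (h + 1)) : Fin (2 * h + 2) :=
  ⟨2 * e.1, by have := e.isLt; omega⟩

/-- The odd-position index `2e+1` in `{0,…,n+1}` (with `n = 2h`). -/
def odIdx (h : ℕ) (e : Fin (h + 1)) : Fin (2 * h + 2) :=
  ⟨2 * e.1 + 1, by have := e.isLt; omega⟩

/-- The index set `I_N`: tuples `(i_0,…,i_{n+1})` with `0 ≤ i_e ≤ d-2` and `∑ i_e = N`,
for `n = 2h` even. -/
abbrev IdxSet (h d N : ℕ) : Type :=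
  {i : Fin (2 * h + 2) → Fin (d - 1) // ∑ e, (i e).1 = N}

/-- The period vector `p^{a,b}` of the linear cycle `ℙ^{n/2}_{a,b}` in the Fermat variety,
extended by zero to all integer tuples. -/
noncomputable def pvec (h d : ℕ) (a : Fin (h + 1) → ℕ) (b : Equiv.Perm (Fin (2 * h + 2)))
    (i : Fin (2 * h + 2) → ℕ) : ℂ :=
  if ∀ e : Fin (h + 1), i (b (evIdx h e)) + i (b (odIdx h e)) = d - 2 then
    zeta2d d ^ (∑ e : Fin (h + 1), (i (b (evIdx h e)) + 1) * (1 + 2 * a e))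
  else 0

/-- The period matrix `[p_{i+j}]` with rows indexed by `I_{(n/2)d-n-2}` and columns by `I_d`. -/
noncomputable def pmat (h d : ℕ) (p : (Fin (2 * h + 2) → ℕ) → ℂ) :
    Matrix (IdxSet h d (h * d - (2 * h + 2))) (IdxSet h d d) ℂ :=
  Matrix.of fun i j => p fun e => (i.1 e).1 + (j.1 e).1

/-- The period vector `P` of the linear cycle with `a = (0,…,0)` and `b = id`. -/
noncomputable def Pvec (h d : ℕ) : (Fin (2 * h + 2) → ℕ) → ℂ :=
  pvec h d (fun _ => 0) (Equiv.refl _)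

/-- The period vector `P̌_m` (with `μ = m+1`): `a` has first `μ` entries `0`, the rest `1`,
and `b = id`. -/
noncomputable def PcheckVec (h d μ : ℕ) : (Fin (2 * h + 2) → ℕ) → ℂ :=
  pvec h d (fun e => if e.1 < μ then 0 else 1) (Equiv.refl _)

/-- The combinatorial constant `C_{α_1,…,α_s}`. -/
def Ccoef (n d : ℕ) {s : ℕ} (α : Fin s → ℕ) : ℤ :=
  ((n + 1 + d).choose (n + 1) : ℤ) -
    ∑ k ∈ Finset.Icc 1 s, (-1 : ℤ) ^ (k - 1) *
      ∑ T ∈ Finset.univ.filter (fun T : Finset (Fin s) => T.card = k ∧ ∑ i ∈ T, α i ≤ d),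
        (((n + 1 + d - ∑ i ∈ T, α i).choose (n + 1) : ℤ))

/-- The sequence `x^s, y^t` (x repeated s times followed by y repeated t times). -/
def twoBlock (x y s t : ℕ) : Fin (s + t) → ℕ := fun i => if i.1 < s then x else y

/-- `K^d_n(m) = 2·C_{1^{n/2+1},(d-1)^{n/2+1}} − C_{1^{n−m+1},(d−1)^{m+1}}`, with `n = 2h`,
`μ = m+1`. -/
def Kdef (h d μ : ℕ) : ℤ :=
  2 * Ccoef (2 * h) d (twoBlock 1 (d - 1) (h + 1) (h + 1)) -
    Ccoef (2 * h) d (twoBlock 1 (d - 1) (2 * h + 2 - μ) μ)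

/-- `H^d_n(m)`: the rank of `[P_{i+j}] + [(P̌_m)_{i+j}]`, with `n = 2h` and `μ = m+1`. -/
noncomputable def sumRank (h d μ : ℕ) : ℕ :=
  (pmat h d (Pvec h d) + pmat h d (PcheckVec h d μ)).rank

/-! ### The constants `K` -/

/-- Recursive evaluation of the inclusion-exclusion sum along a list of weights. -/
def GCoef (n : ℕ) : List ℕ → ℕ → ℤ
  | [], D => ((n + 1 + D).choose (n + 1) : ℤ)
  | a :: l, D => GCoef n l D - if a ≤ D then GCoef n l (D - a) else 0

theorem sum_powerset_eq_GCoef {ι : Type*} [DecidableEq ι] (n : ℕ) (α : ι → ℕ) (l : List ι)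
    (hl : l.Nodup) (D : ℕ) :
    ∑ T ∈ l.toFinset.powerset, (if ∑ i ∈ T, α i ≤ D then
      (-1 : ℤ) ^ T.card * ((n + 1 + D - ∑ i ∈ T, α i).choose (n + 1) : ℤ) else 0)
      = GCoef n (l.map α) D := by
  induction l generalizing D with
  | nil => simp [GCoef]
  | cons a l ih =>
    have ha : a ∉ l.toFinset := by
      rw [List.mem_toFinset]; exact (List.nodup_cons.1 hl).1
    have hl' := (List.nodup_cons.1 hl).2
    rw [List.toFinset_cons, Finset.sum_powerset_insert ha, ih hl' D, List.map_cons, GCoef,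
      sub_eq_add_neg]
    congr 1
    split_ifs with h
    · rw [← ih hl' (D - α a), ← Finset.sum_neg_distrib]
      refine Finset.sum_congr rfl fun T hT => ?_
      have haT : a ∉ T := fun hh => ha (Finset.mem_powerset.1 hT hh)
      rw [Finset.sum_insert haT, Finset.card_insert_of_notMem haT]
      by_cases h2 : ∑ i ∈ T, α i ≤ D - α a
      · rw [if_pos h2, if_pos (by omega)]
        have : n + 1 + D - (α a + ∑ i ∈ T, α i) = n + 1 + (D - α a) - ∑ i ∈ T, α i := by omega
        rw [this, pow_succ]; ring
      · rw [if_neg h2, if_neg (by omega)]; simp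
    · rw [neg_zero]
      refine Finset.sum_eq_zero fun T hT => ?_
      have haT : a ∉ T := fun hh => ha (Finset.mem_powerset.1 hT hh)
      rw [Finset.sum_insert haT, if_neg (by omega)]

theorem Ccoef_eq_GCoef (n d : ℕ) {s : ℕ} (α : Fin s → ℕ) :
    Ccoef n d α = GCoef n ((List.finRange s).map α) d := by
  rw [← sum_powerset_eq_GCoef n α _ (List.nodup_finRange s) d]
  have hu : (List.finRange s).toFinset = Finset.univ := by ext; simp
  rw [hu, Finset.powerset_univ, Ccoef]
  have h1 : ∀ T : Finset (Fin s), T.card ∈ Finset.range (s + 1) := fun T => by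
    have := Finset.card_le_univ T
    simp at this ⊢; omega
  rw [← Finset.sum_fiberwise_of_maps_to (s := Finset.univ) (t := Finset.range (s + 1))
    (g := fun T : Finset (Fin s) => T.card) (fun T _ => h1 T)]
  rw [Finset.sum_range_succ', sub_eq_neg_add]
  congr 1
  · rw [← Finset.sum_neg_distrib, Finset.range_eq_Ico,
      Finset.sum_Ico_add' (fun k => ∑ T : Finset (Fin s) with T.card = k,
        if ∑ i ∈ T, α i ≤ d then
      (-1 : ℤ) ^ T.card * ((n + 1 + d - ∑ i ∈ T, α i).choose (n + 1) : ℤ) else 0) 0 s 1]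
    refine Finset.sum_congr (by ext; simp; try omega) fun k hk => ?_
    have hk1 : 1 ≤ k := by simp at hk; omega
    obtain ⟨k, rfl⟩ : ∃ k', k = k' + 1 := ⟨k - 1, by omega⟩
    rw [← Finset.filter_filter, Finset.sum_filter (p := fun T => ∑ i ∈ T, α i ≤ d),
      ← neg_mul, Finset.mul_sum]
    refine Finset.sum_congr rfl fun T hT => ?_
    rw [(Finset.mem_filter.1 hT).2]
    split_ifs
    · rw [Nat.add_sub_cancel, pow_succ]; ring
    · simp
  · simp [Finset.card_eq_zero, Finset.filter_eq']

/-! ### The rank of a block matrix of Vandermonde type -/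

theorem vander_indep {I U : Type*} [Fintype I] [Fintype U] (ρ : I → U → Prop)
    (hρ : ∀ i v w, ρ i v → ρ i w → v = w) (A G : U → Prop)
    (hAG : ∀ v, A v → ¬ G v) (x : I → ℂ) (hx : ∀ i, x i ≠ 0) (s : I → ℕ)
    (t κ η : ℂ) (hκ : κ ≠ 0) (hη : η ≠ 1)
    (h0 : ∀ v, ∃ i, ρ i v ∧ s i = 0) (h1 : ∀ v, A v ∨ G v → ∃ i, ρ i v ∧ s i = 1)
    (W : I → U ⊕ {v : U // G v} → ℂ)
    (hWl : ∀ i v, ρ i v → ¬ A v → W i (Sum.inl v) = x i)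
    (hWA : ∀ i v, ρ i v → A v → W i (Sum.inl v) = x i * (1 + t * η ^ s i))
    (hWr : ∀ i v, ρ i v.1 → W i (Sum.inr v) = x i * (κ * η ^ s i))
    (hWl0 : ∀ i v, ¬ ρ i v → W i (Sum.inl v) = 0)
    (hWr0 : ∀ i v, ¬ ρ i v.1 → W i (Sum.inr v) = 0)
    [Fintype {v : U // G v}]
    (c : U ⊕ {v : U // G v} → ℂ) (hc : ∀ i, ∑ k, W i k * c k = 0) : c = 0 := by
  classical
  have e1 : ∀ i v, ρ i v → ∑ k : U, W i (Sum.inl k) * c (Sum.inl k)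
      = W i (Sum.inl v) * c (Sum.inl v) := fun i v hiv =>
    Fintype.sum_eq_single v fun w hw => by
      rw [hWl0 i w fun h => hw (hρ i w v h hiv), zero_mul]
  have e2 : ∀ i v, ρ i v → ¬ G v → ∑ k : {v : U // G v}, W i (Sum.inr k) * c (Sum.inr k) = 0 :=
    fun i v hiv hG => Finset.sum_eq_zero fun w _ => by
      rw [hWr0 i w fun h => hG (hρ i w v h hiv ▸ w.2), zero_mul]
  have e3 : ∀ i (v : {v : U // G v}), ρ i v.1 →
      ∑ k : {v : U // G v}, W i (Sum.inr k) * c (Sum.inr k) = W i (Sum.inr v) * c (Sum.inr v) :=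
    fun i v hiv => Fintype.sum_eq_single v fun w hw => by
      rw [hWr0 i w fun h => hw (Subtype.ext (hρ i w v h hiv)), zero_mul]
  have hη' : η - 1 ≠ 0 := sub_ne_zero.2 hη
  have key : ∀ v, c (Sum.inl v) = 0 ∧ ∀ hG : G v, c (Sum.inr ⟨v, hG⟩) = 0 := by
    intro v
    obtain ⟨i, hi, si⟩ := h0 v
    have E0 := hc i
    rw [Fintype.sum_sum_type, e1 i v hi] at E0
    by_cases hG : G v
    · have hA : ¬ A v := fun h => hAG v h hG
      obtain ⟨j, hj, sj⟩ := h1 v (Or.inr hG)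
      have E1 := hc j
      rw [Fintype.sum_sum_type, e1 j v hj, e3 j ⟨v, hG⟩ hj, hWl j v hj hA, hWr j ⟨v, hG⟩ hj, sj] at E1
      rw [e3 i ⟨v, hG⟩ hi, hWl i v hi hA, hWr i ⟨v, hG⟩ hi, si] at E0
      have F0 : c (Sum.inl v) + κ * c (Sum.inr ⟨v, hG⟩) = 0 :=
        mul_left_cancel₀ (hx i) (by linear_combination E0)
      have F1 : c (Sum.inl v) + κ * η * c (Sum.inr ⟨v, hG⟩) = 0 :=
        mul_left_cancel₀ (hx j) (by linear_combination E1)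
      have F2 : c (Sum.inr ⟨v, hG⟩) = 0 :=
        mul_left_cancel₀ (mul_ne_zero hκ hη') (by linear_combination F1 - F0)
      refine ⟨?_, fun _ => F2⟩
      rw [F2] at F0; simpa using F0
    · refine ⟨?_, fun h => absurd h hG⟩
      rw [e2 i v hi hG, add_zero] at E0
      by_cases hA : A v
      · obtain ⟨j, hj, sj⟩ := h1 v (Or.inl hA)
        have E1 := hc j
        rw [Fintype.sum_sum_type, e1 j v hj, e2 j v hj hG, hWA j v hj hA, sj, add_zero] at E1
        rw [hWA i v hi hA, si] at E0
        have F0 : (1 + t) * c (Sum.inl v) = 0 :=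
          mul_left_cancel₀ (hx i) (by linear_combination E0)
        have F1 : (1 + t * η) * c (Sum.inl v) = 0 :=
          mul_left_cancel₀ (hx j) (by linear_combination E1)
        exact mul_left_cancel₀ hη' (by linear_combination η * F0 - F1)
      · rw [hWl i v hi hA] at E0
        exact (mul_eq_zero.1 E0).resolve_left (hx i)
  funext k
  rcases k with v | ⟨v, hG⟩
  · exact (key v).1
  · exact (key v).2 hG

theorem rank_mul_of_indep {I J K : Type*} [Fintype I] [Fintype J] [Fintype K]
    (L : Matrix I K ℂ) (R : Matrix K J ℂ)
    (hL : ∀ c : K → ℂ, (∀ i, ∑ k, L i k * c k = 0) → c = 0)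
    (hR : ∀ c : K → ℂ, (∀ j, ∑ k, R k j * c k = 0) → c = 0) :
    (L * R).rank = Fintype.card K := by
  classical
  have hRr : R.rank = Fintype.card K := by
    apply LinearIndependent.rank_matrix
    rw [Fintype.linearIndependent_iff]
    intro g hg k
    refine congrFun (hR g fun j => ?_) k
    have := congrFun hg j
    simpa [Finset.sum_apply, mul_comm, Matrix.row] using this
  have hinj : Function.Injective L.mulVecLin := by
    rw [injective_iff_map_eq_zero]
    intro c hc
    exact hL c fun i => congrFun hc i
  rw [Matrix.rank, Matrix.mulVecLin_mul, LinearMap.range_comp]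
  rw [← hRr, Matrix.rank]
  exact (Submodule.equivMapOfInjective _ hinj _).finrank_eq.symm

theorem vander_rank {I J U : Type*} [Fintype I] [Fintype J] [Fintype U]
    (ρ : I → U → Prop) (τ : J → U → Prop)
    (hρ : ∀ i v w, ρ i v → ρ i w → v = w) (hτ : ∀ j v w, τ j v → τ j w → v = w)
    (lo hi : U → Prop) (hlh : ∀ v, lo v → ¬ hi v)
    [Fintype {v : U // ¬ lo v ∧ ¬ hi v}]
    (x : I → ℂ) (y : J → ℂ) (hx : ∀ i, x i ≠ 0) (hy : ∀ j, y j ≠ 0)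
    (s : I → ℕ) (s' : J → ℕ) (t η : ℂ) (ht : t ≠ 0) (hη : η ≠ 1)
    (hlo : ∀ i v, ρ i v → lo v → s i = 0) (hhi : ∀ j v, τ j v → hi v → s' j = 0)
    (h0 : ∀ v, ∃ i, ρ i v ∧ s i = 0) (h1 : ∀ v, ¬ lo v → ∃ i, ρ i v ∧ s i = 1)
    (h0' : ∀ v, ∃ j, τ j v ∧ s' j = 0) (h1' : ∀ v, ¬ hi v → ∃ j, τ j v ∧ s' j = 1)
    (M : Matrix I J ℂ)
    (hM : ∀ i j v, ρ i v → τ j v → M i j = x i * y j * (1 + t * (η ^ s i * η ^ s' j)))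
    (hM0 : ∀ i j, (∀ v, ρ i v → ¬ τ j v) → M i j = 0) :
    M.rank = Fintype.card U + Fintype.card {v : U // ¬ lo v ∧ ¬ hi v} := by
  classical
  let L : Matrix I (U ⊕ {v : U // ¬ lo v ∧ ¬ hi v}) ℂ := Matrix.of fun i k =>
    Sum.elim (fun v => if ρ i v then (if hi v then x i * (1 + t * η ^ s i) else x i) else 0)
      (fun v => if ρ i v.1 then x i * (t * η ^ s i) else 0) k
  let R : Matrix (U ⊕ {v : U // ¬ lo v ∧ ¬ hi v}) J ℂ := Matrix.of fun k j =>
    Sum.elim (fun v => if τ j v then (if lo v then y j * (1 + t * η ^ s' j) else y j) else 0)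
      (fun v => if τ j v.1 then y j * (1 * η ^ s' j) else 0) k
  have hLR : M = L * R := by
    ext i j
    rw [Matrix.mul_apply, Fintype.sum_sum_type]
    by_cases hv : ∃ v, ρ i v ∧ τ j v
    · obtain ⟨v, hi1, hj1⟩ := hv
      rw [hM i j v hi1 hj1]
      rw [Fintype.sum_eq_single v fun w hw => by
        have : ¬ ρ i w := fun h => hw (hρ i w v h hi1)
        simp [L, this]]
      by_cases hG : ¬ lo v ∧ ¬ hi v
      · rw [Fintype.sum_eq_single ⟨v, hG⟩ fun w hw => by
          have : ¬ ρ i w.1 := fun h => hw (Subtype.ext (hρ i w v h hi1))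
          simp [L, this]]
        simp [L, R, hi1, hj1, hG.1, hG.2]; ring
      · rw [Finset.sum_eq_zero fun w _ => by
          have : ¬ ρ i w.1 := fun h => hG (hρ i w v h hi1 ▸ w.2)
          simp [L, this]]
        by_cases hl : lo v
        · simp [L, R, hi1, hj1, hl, hlh v hl, hlo i v hi1 hl]; ring
        · have hh : hi v := by tauto
          simp [L, R, hi1, hj1, hl, hh, hhi j v hj1 hh]; ring
    · push Not at hv
      rw [hM0 i j hv]
      rw [Finset.sum_eq_zero, Finset.sum_eq_zero, add_zero]
      · intro w _
        by_cases h : ρ i w.1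
        · simp [R, hv _ h]
        · simp [L, h]
      · intro w _
        by_cases h : ρ i w
        · simp [R, hv _ h]
        · simp [L, h]
  rw [hLR, rank_mul_of_indep L R, Fintype.card_sum]
  · refine vander_indep ρ hρ hi (fun v => ¬ lo v ∧ ¬ hi v) (fun v h h' => h'.2 h) x hx s t t η ht hη
      h0 (fun v hv => h1 v ?_) L ?_ ?_ ?_ ?_ ?_
    · rcases hv with h | h
      · exact fun hl => hlh v hl h
      · exact h.1
    · intro i v h1 h2; simp [L, h1, h2]
    · intro i v h1 h2; simp [L, h1, h2]
    · intro i v h1; simp [L, h1]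
    · intro i v h1; simp [L, h1]
    · intro i v h1; simp [L, h1]
  · refine vander_indep τ hτ lo (fun v => ¬ lo v ∧ ¬ hi v) (fun v h h' => h'.1 h) y hy s' t 1 η
      one_ne_zero hη h0' (fun v hv => h1' v ?_) (fun j k => R k j) ?_ ?_ ?_ ?_ ?_
    · rcases hv with h | h
      · exact hlh v h
      · exact h.2
    · intro i v h1 h2; simp [R, h1, h2]
    · intro i v h1 h2; simp [R, h1, h2]
    · intro i v h1; simp [R, h1]
    · intro i v h1; simp [R, h1]
    · intro i v h1; simp [R, h1]

/-! ### Application to the period matrices -/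

theorem sum_ev_od {M : Type*} [AddCommMonoid M] (h : ℕ) (f : Fin (2 * h + 2) → M) :
    ∑ k, f k = ∑ e, (f (evIdx h e) + f (odIdx h e)) := by
  induction h with
  | zero => simp [Fin.sum_univ_two, evIdx, odIdx]
  | succ h ih =>
    have e : ∑ k, f k = ∑ k : Fin (2 * h + 2 + 1 + 1), f k := rfl
    rw [e, Fin.sum_univ_castSucc, Fin.sum_univ_castSucc (n := 2 * h + 2),
      Fin.sum_univ_castSucc (n := h + 1), ih (fun k => f k.castSucc.castSucc), add_assoc]
    rfl

/-- The tuple with prescribed even and odd entries. -/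
def mkTuple (h : ℕ) {X : Type*} (w v : Fin (h + 1) → X) (k : Fin (2 * h + 2)) : X :=
  if k.1 % 2 = 0 then w ⟨k.1 / 2, by omega⟩ else v ⟨k.1 / 2, by omega⟩

theorem mkTuple_ev (h : ℕ) {X : Type*} (w v : Fin (h + 1) → X) (e : Fin (h + 1)) :
    mkTuple h w v (evIdx h e) = w e := by
  simp [mkTuple, evIdx]

theorem mkTuple_od (h : ℕ) {X : Type*} (w v : Fin (h + 1) → X) (e : Fin (h + 1)) :
    mkTuple h w v (odIdx h e) = v e := by
  have : (2 * e.1 + 1) / 2 = e.1 := by omega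
  simp [mkTuple, odIdx, this]

/-- The weight of the last two blocks. -/
def sdeg (h μ : ℕ) (i : Fin (2 * h + 2) → ℕ) : ℕ :=
  ∑ e : Fin (h + 1), (if e.1 < μ then 0 else 1) * i (evIdx h e)

/-- Existence of a tuple with prescribed block degrees and weight zero. -/
theorem exists_tuple_zero (h d μ N : ℕ) (hd : 3 ≤ d) (u : Fin (h + 1) → ℕ) (hu : ∀ e, u e ≤ d - 2)
    (hs : ∑ e, u e = N) : ∃ i : IdxSet h d N,
      (∀ e, (i.1 (evIdx h e)).1 + (i.1 (odIdx h e)).1 = u e) ∧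
      sdeg h μ (fun k => (i.1 k).1) = 0 := by
  refine ⟨⟨mkTuple h (fun _ => ⟨0, by omega⟩) (fun e => ⟨u e, by have := hu e; omega⟩), ?_⟩, ?_, ?_⟩
  · rw [sum_ev_od]; simp [mkTuple_ev, mkTuple_od, hs]
  · intro e; simp [mkTuple_ev, mkTuple_od]
  · simp [sdeg, mkTuple_ev]

/-- Existence of a tuple with prescribed block degrees and weight one. -/
theorem exists_tuple_one (h d μ N : ℕ) (hd : 3 ≤ d) (u : Fin (h + 1) → ℕ) (hu : ∀ e, u e ≤ d - 2)
    (hs : ∑ e, u e = N) (e₀ : Fin (h + 1)) (he₀ : μ ≤ e₀.1) (hue : u e₀ ≠ 0) :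
    ∃ i : IdxSet h d N,
      (∀ e, (i.1 (evIdx h e)).1 + (i.1 (odIdx h e)).1 = u e) ∧
      sdeg h μ (fun k => (i.1 k).1) = 1 := by
  have key : ∀ e, (if e = e₀ then 1 else 0) + (u e - (if e = e₀ then 1 else 0)) = u e := by
    intro e
    split_ifs with h
    · subst h; omega
    · omega
  refine ⟨⟨mkTuple h (fun e => ⟨if e = e₀ then 1 else 0, by split_ifs <;> omega⟩)
    (fun e => ⟨u e - (if e = e₀ then 1 else 0), by have := hu e; omega⟩), ?_⟩, ?_, ?_⟩
  · rw [sum_ev_od, ← hs]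
    refine Finset.sum_congr rfl fun e _ => ?_
    simp only [mkTuple_ev, mkTuple_od]; exact key e
  · intro e; simp only [mkTuple_ev, mkTuple_od]; exact key e
  · simp only [sdeg, mkTuple_ev]
    rw [Fintype.sum_eq_single e₀ fun e he => by simp [he]]
    simp; omega

/-- Block degree vectors of the rows. -/
abbrev UIdx (h d : ℕ) : Type :=
  {u : Fin (h + 1) → Fin (d - 1) // ∑ e, (u e).1 = h * d - (2 * h + 2)}

theorem zeta2d_ne_zero (d : ℕ) : zeta2d d ≠ 0 := Complex.exp_ne_zero _

theorem zeta2d_sq_ne_one (d : ℕ) (hd : 3 ≤ d) : zeta2d d ^ 2 ≠ 1 := by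
  have h : IsPrimitiveRoot (zeta2d d) (2 * d) := by
    have := Complex.isPrimitiveRoot_exp (2 * d) (by omega)
    simpa [zeta2d] using this
  exact h.pow_ne_one_of_pos_of_lt (by omega) (by omega)

theorem sumRank_eq (μ d : ℕ) (hd : 3 ≤ d) (hN : 2 * (μ + 1) + 2 ≤ (μ + 1) * d) :
    sumRank (μ + 1) d μ = Fintype.card (UIdx (μ + 1) d) +
      Fintype.card {v : UIdx (μ + 1) d // ¬ (∀ e : Fin (μ + 1 + 1), μ ≤ e.1 → (v.1 e).1 = 0) ∧
        ¬ (∀ e : Fin (μ + 1 + 1), μ ≤ e.1 → (v.1 e).1 = d - 2)} := by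
  obtain ⟨h, hh⟩ : ∃ h, h = μ + 1 := ⟨_, rfl⟩
  rw [← hh] at hN ⊢
  have hω := zeta2d_ne_zero d
  let Adeg : (Fin (2 * h + 2) → ℕ) → ℕ := fun i => ∑ e, i (evIdx h e)
  have hlt : ∀ (v : UIdx h d) e, (v.1 e).1 ≤ d - 2 := fun v e => by
    have := (v.1 e).isLt; omega
  have hcs : ∀ v : UIdx h d, ∑ e, (d - 2 - (v.1 e).1) = d := by
    intro v
    have h1 : ∑ e, (d - 2 - (v.1 e).1) + ∑ e, (v.1 e).1 = (h + 1) * (d - 2) := by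
      rw [← Finset.sum_add_distrib, Finset.sum_congr rfl (fun e _ => Nat.sub_add_cancel (hlt v e))]
      simp
    rw [v.2] at h1
    obtain ⟨k, rfl⟩ : ∃ k, d = k + 3 := ⟨d - 3, by omega⟩
    have h2 : k + 3 - 2 = k + 1 := by omega
    rw [h2] at h1 ⊢
    have h3 : h * (k + 3) = h * k + 3 * h := by ring
    have h4 : (h + 1) * (k + 1) = h * k + h + k + 1 := by ring
    rw [h3] at hN
    generalize ∑ e, (k + 1 - (v.1 e).1) = S at h1 ⊢
    rw [h3, h4] at h1
    omega
  refine vander_rank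
    (ρ := fun (i : IdxSet h d (h * d - (2 * h + 2))) (v : UIdx h d) =>
      ∀ e, (i.1 (evIdx h e)).1 + (i.1 (odIdx h e)).1 = (v.1 e).1)
    (τ := fun (j : IdxSet h d d) (v : UIdx h d) =>
      ∀ e, (v.1 e).1 + ((j.1 (evIdx h e)).1 + (j.1 (odIdx h e)).1) = d - 2)
    ?_ ?_ _ _ ?_
    (x := fun i => zeta2d d ^ (h + 1) * zeta2d d ^ Adeg (fun k => (i.1 k).1))
    (y := fun j => zeta2d d ^ Adeg (fun k => (j.1 k).1))
    (fun i => mul_ne_zero (pow_ne_zero _ hω) (pow_ne_zero _ hω)) (fun j => pow_ne_zero _ hω)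
    (s := fun i => sdeg h μ (fun k => (i.1 k).1)) (s' := fun j => sdeg h μ (fun k => (j.1 k).1))
    (t := zeta2d d ^ 4) (η := zeta2d d ^ 2) (pow_ne_zero _ hω) (zeta2d_sq_ne_one d hd)
    ?_ ?_ ?_ ?_ ?_ ?_ _ ?_ ?_
  · intro i v w hv hw
    ext e; rw [← hv e, ← hw e]
  · intro i v w hv hw
    ext e; have := hv e; have := hw e; omega
  · intro v hl hh'
    have a := hl ⟨μ, by omega⟩ le_rfl
    have b := hh' ⟨μ, by omega⟩ le_rfl
    omega
  · intro i v hv hl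
    refine Finset.sum_eq_zero fun e _ => ?_
    split_ifs with he
    · simp
    · have := hv e; have := hl e (by omega); simp; omega
  · intro i v hv hl
    refine Finset.sum_eq_zero fun e _ => ?_
    split_ifs with he
    · simp
    · have := hv e; have := hl e (by omega); simp; omega
  · intro v
    exact exists_tuple_zero h d μ _ hd (fun e => (v.1 e).1) (hlt v) v.2
  · intro v hl
    push Not at hl
    obtain ⟨e, he, he'⟩ := hl
    exact exists_tuple_one h d μ _ hd (fun e => (v.1 e).1) (hlt v) v.2 e he he'
  · intro v
    obtain ⟨j, hj, hs⟩ := exists_tuple_zero h d μ d hd (fun e => d - 2 - (v.1 e).1)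
      (fun e => by omega) (hcs v)
    exact ⟨j, fun e => by have := hj e; have := hlt v e; omega, hs⟩
  · intro v hl
    push Not at hl
    obtain ⟨e, he, he'⟩ := hl
    obtain ⟨j, hj, hs⟩ := exists_tuple_one h d μ d hd (fun e => d - 2 - (v.1 e).1)
      (fun e => by omega) (hcs v) e he (by have := hlt v e; omega)
    exact ⟨j, fun e => by have := hj e; have := hlt v e; omega, hs⟩
  · intro i j v hv hw
    have hc : ∀ e : Fin (h + 1), (i.1 (evIdx h e)).1 + (j.1 (evIdx h e)).1 +
        ((i.1 (odIdx h e)).1 + (j.1 (odIdx h e)).1) = d - 2 := fun e => by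
      have := hv e; have := hw e; omega
    have hp : ∑ e : Fin (h + 1), ((i.1 (evIdx h e)).1 + (j.1 (evIdx h e)).1 + 1) * (1 + 2 * 0)
        = (h + 1) + Adeg (fun k => (i.1 k).1) + Adeg (fun k => (j.1 k).1) := by
      simp [Adeg, Finset.sum_add_distrib]; ring
    have hq0 : ∑ e : Fin (h + 1), (if e.1 < μ then 0 else 1) = 2 := by
      subst hh
      rw [Fin.sum_univ_castSucc, Fin.sum_univ_castSucc]
      simp
    have hq : ∑ e : Fin (h + 1), ((i.1 (evIdx h e)).1 + (j.1 (evIdx h e)).1 + 1) *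
        (1 + 2 * (if e.1 < μ then 0 else 1))
        = (h + 1) + Adeg (fun k => (i.1 k).1) + Adeg (fun k => (j.1 k).1) + 4 +
          2 * sdeg h μ (fun k => (i.1 k).1) + 2 * sdeg h μ (fun k => (j.1 k).1) := by
      have : (4 : ℕ) = 2 * ∑ e : Fin (h + 1), (if e.1 < μ then 0 else 1) := by rw [hq0]
      rw [← hp, this]
      simp only [sdeg, Finset.mul_sum, ← Finset.sum_add_distrib]
      refine Finset.sum_congr rfl fun e _ => ?_
      ring
    simp only [Matrix.add_apply, pmat, Matrix.of_apply, Pvec, PcheckVec]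
    have g1 : pvec h d (fun _ => 0) (Equiv.refl _) (fun e => (i.1 e).1 + (j.1 e).1) = _ :=
      (if_pos hc).trans (congrArg (fun k => zeta2d d ^ k) hp)
    have g2 : pvec h d (fun e => if e.1 < μ then 0 else 1) (Equiv.refl _)
        (fun e => (i.1 e).1 + (j.1 e).1) = _ :=
      (if_pos hc).trans (congrArg (fun k => zeta2d d ^ k) hq)
    rw [g1, g2]
    simp only [pow_add, pow_mul]
    ring
  · intro i j hv
    have hc : ¬ ∀ e : Fin (h + 1), (i.1 (evIdx h e)).1 + (j.1 (evIdx h e)).1 +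
        ((i.1 (odIdx h e)).1 + (j.1 (odIdx h e)).1) = d - 2 := by
      intro hc
      refine hv ⟨fun e => ⟨(i.1 (evIdx h e)).1 + (i.1 (odIdx h e)).1, ?_⟩, ?_⟩ (fun e => rfl) ?_
      · have := hc e; omega
      · have := i.2
        rw [sum_ev_od] at this
        exact this
      · intro e; have := hc e; simp only; omega
    simp only [Matrix.add_apply, pmat, Matrix.of_apply, Pvec, PcheckVec]
    have g : ∀ a, pvec h d a (Equiv.refl _) (fun e => (i.1 e).1 + (j.1 e).1) = 0 :=
      fun a => if_neg hc
    rw [g, g, add_zero]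

theorem sumRank_3_3 : sumRank 3 3 2 = 6 := by
  rw [sumRank_eq 2 3 (by norm_num) (by norm_num)]; decide +kernel
theorem sumRank_4_3 : sumRank 4 3 3 = 16 := by
  rw [sumRank_eq 3 3 (by norm_num) (by norm_num)]; decide +kernel
theorem sumRank_5_3 : sumRank 5 3 4 = 32 := by
  rw [sumRank_eq 4 3 (by norm_num) (by norm_num)]; decide +kernel
theorem sumRank_6_3 : sumRank 6 3 5 = 55 := by
  rw [sumRank_eq 5 3 (by norm_num) (by norm_num)]; decide +kernel
theorem sumRank_2_4 : sumRank 2 4 1 = 11 := by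
  rw [sumRank_eq 1 4 (by norm_num) (by norm_num)]; decide +kernel
theorem sumRank_3_4 : sumRank 3 4 2 = 36 := by
  rw [sumRank_eq 2 4 (by norm_num) (by norm_num)]; decide +kernel

theorem Kdef_3_3 : Kdef 3 3 2 = 8 := by
  simp only [Kdef, Ccoef_eq_GCoef]; decide +kernel
theorem Kdef_4_3 : Kdef 4 3 3 = 19 := by
  simp only [Kdef, Ccoef_eq_GCoef]; decide +kernel
theorem Kdef_5_3 : Kdef 5 3 4 = 36 := by
  simp only [Kdef, Ccoef_eq_GCoef]; decide +kernel
theorem Kdef_6_3 : Kdef 6 3 5 = 60 := by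
  simp only [Kdef, Ccoef_eq_GCoef]; decide +kernel
theorem Kdef_2_4 : Kdef 2 4 1 = 12 := by
  simp only [Kdef, Ccoef_eq_GCoef]; decide +kernel
theorem Kdef_3_4 : Kdef 3 4 2 = 37 := by
  simp only [Kdef, Ccoef_eq_GCoef]; decide +kernel

/-- For the triples `(n,d,m) = (6,3,1), (8,3,2), (10,3,3), (12,3,4), (4,4,0), (6,4,1)`
(each with `m = n/2 − 2`, encoded by `h = n/2`, `μ = m+1 = h−1`), one has the strict
inequality `rank([P_{i+j}] + [(P̌_m)_{i+j}]) < K^d_n(m)`, the two sides being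
`(6,8), (16,19), (32,36), (55,60), (11,12), (36,37)` respectively. -/
theorem rank_lt_K_at_codim_two :
    ((sumRank 3 3 2 : ℤ) < Kdef 3 3 2 ∧ sumRank 3 3 2 = 6 ∧ Kdef 3 3 2 = 8) ∧
    ((sumRank 4 3 3 : ℤ) < Kdef 4 3 3 ∧ sumRank 4 3 3 = 16 ∧ Kdef 4 3 3 = 19) ∧
    ((sumRank 5 3 4 : ℤ) < Kdef 5 3 4 ∧ sumRank 5 3 4 = 32 ∧ Kdef 5 3 4 = 36) ∧
    ((sumRank 6 3 5 : ℤ) < Kdef 6 3 5 ∧ sumRank 6 3 5 = 55 ∧ Kdef 6 3 5 = 60) ∧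
    ((sumRank 2 4 1 : ℤ) < Kdef 2 4 1 ∧ sumRank 2 4 1 = 11 ∧ Kdef 2 4 1 = 12) ∧
    ((sumRank 3 4 2 : ℤ) < Kdef 3 4 2 ∧ sumRank 3 4 2 = 36 ∧ Kdef 3 4 2 = 37) := by
  rw [sumRank_3_3, sumRank_4_3, sumRank_5_3, sumRank_6_3, sumRank_2_4, sumRank_3_4,
    Kdef_3_3, Kdef_4_3, Kdef_5_3, Kdef_6_3, Kdef_2_4, Kdef_3_4]
  norm_num
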